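/- arXiv:1609.00910 — 8 statements merged into one kernel-verified Lean document; each statement's English description precedes it below -/
import Mathlib

section
/- Let n ≥ 1 and m > n+1 be natural numbers, and let f = (f_0, …, f_n) be a tuple of homogeneous polynomials of degree m in the variables x_0, …, x_n over ℂ whose only common zero in ℂ^{n+1} is the origin. Suppose g and h are unipotent matrices in GL_{n+1}(ℂ) (i.e. (g − 1)^{n+1} = 0 and (h − 1)^{n+1} = 0) and that there exists a nonzero scalar μ ∈ ℂ such that for every j one has the identity of polynomials f_j(g·x) = μ · Σ_{k=0}^{n} h_{jk} f_k(x), where g·x denotes the linear substitution of variables by g. Then g = 1 and h = 1. (In other words, for m > n+1 no nontrivial unipotent element of PGL_{n+1} × PGL_{n+1} stabilizes a morphism ℙ^n → ℙ^n given by degree-m polynomials.) -/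
open MvPolynomial

/-- Evaluation of a homogeneous polynomial scales with the degree. -/
theorem MvPolynomial.IsHomogeneous.eval_smul_point {σ R : Type*} [CommRing R]
    {p : MvPolynomial σ R} {m : ℕ} (hp : p.IsHomogeneous m) (c : R) (x : σ → R) :
    eval (c • x) p = c ^ m * eval x p := by
  rw [eval_eq, eval_eq, Finset.mul_sum]
  refine Finset.sum_congr rfl fun d hd => ?_
  have hdeg : ∑ i ∈ d.support, d i = m := by
    have := hp (mem_support_iff.mp hd)
    simpa [Finsupp.weight_apply, Finsupp.sum] using this
  simp only [Pi.smul_apply, smul_eq_mul, mul_pow, Finset.prod_mul_distrib,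
    Finset.prod_pow_eq_pow_sum, hdeg]
  ring

/-- Polynomials indexed by `ι`, in the variables `ι`, with exactly one common zero are linearly
independent. -/
theorem MvPolynomial.linearIndependent_of_unique_zero {K ι : Type*} [Field K] [IsAlgClosed K]
    [Fintype ι] (f : ι → MvPolynomial ι K) (a : ι → K)
    (hf : ∀ x, (∀ j, eval x (f j) = 0) ↔ x = a) : LinearIndependent K f := by
  classical
  by_contra hdep
  obtain ⟨c, hc, j₀, hj₀⟩ := Fintype.not_linearIndependent_iff.mp hdep
  have hdim : ringKrullDim (MvPolynomial ι K) = (Fintype.card ι : WithBot ℕ∞) := by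
    rw [ringKrullDim_of_isNoetherianRing, ringKrullDim_eq_zero_of_field, zero_add,
      Nat.card_eq_fintype_card]
  have : FiniteRingKrullDim (MvPolynomial ι K) := by
    rw [finiteRingKrullDim_iff_ne_bot_and_top, hdim]
    exact ⟨WithBot.natCast_ne_bot _, fun hcard =>
      ENat.natCast_ne_top _ (WithBot.coe_injective hcard)⟩
  obtain ⟨M, hM, hMh⟩ := Ideal.exists_isMaximal_height (R := MvPolynomial ι K)
  obtain ⟨b, rfl⟩ := eq_vanishingIdeal_singleton_of_isMaximal K hM
  -- Move the common zero from `a` to `b`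
  set t : ι → MvPolynomial ι K := fun j => aeval (fun i => X i + C (a i - b i)) (f j) with ht
  have hteval (x : ι → K) (j : ι) : eval x (t j) = eval (x + (a - b)) (f j) := by
    simp only [ht, aeval_def, algebraMap_eq, ← coe_eval₂Hom, ← RingHom.comp_apply]
    congr 1
    ext <;> simp
  set s : Finset (MvPolynomial ι K) := (Finset.univ.erase j₀).image t with hs
  have hzero (x : ι → K) (hx : ∀ p ∈ s, eval x p = 0) : x = b := by
    have hne (j : ι) (hj : j ≠ j₀) : eval (x + (a - b)) (f j) = 0 := by
      rw [← hteval]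
      exact hx _ (Finset.mem_image_of_mem _ (by simp [hj]))
    have hsum := congrArg (eval (x + (a - b))) hc
    rw [map_sum, Finset.sum_eq_single j₀ (fun j _ hj => by simp [smul_eval, hne j hj]) (by simp),
      smul_eval, map_zero] at hsum
    have hx' := (hf (x + (a - b))).mp fun j => by
      by_cases hj : j = j₀
      · exact hj ▸ (mul_eq_zero.mp hsum).resolve_left hj₀
      · exact hne j hj
    simpa [add_sub_left_comm x a b, sub_eq_zero] using hx'
  have hle : Ideal.span (s : Set (MvPolynomial ι K)) ≤ vanishingIdeal K {b} := by
    rw [Ideal.span_le]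
    intro p hp
    obtain ⟨j, -, rfl⟩ := Finset.mem_image.mp (Finset.mem_coe.mp hp)
    rw [SetLike.mem_coe, mem_vanishingIdeal_singleton_iff, aeval_eq_eval, hteval,
      add_sub_cancel]
    exact (hf a).mpr rfl j
  have hmin : vanishingIdeal K {b} ∈
      (Ideal.span (s : Set (MvPolynomial ι K))).minimalPrimes := by
    refine ⟨⟨inferInstance, hle⟩, fun P hP _ => ?_⟩
    have := hP.1
    rw [← IsPrime.vanishingIdeal_zeroLocus (K := K) P]
    refine vanishingIdeal_anti_mono fun x hx => ?_
    refine hzero x fun p hp => ?_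
    have := hx p (hP.2 (Ideal.subset_span hp))
    rwa [aeval_eq_eval] at this
  have hh := Ideal.height_le_card_of_mem_minimalPrimes_span_finset hmin
  have hcard : s.card < Fintype.card ι :=
    Finset.card_image_le.trans_lt (Finset.card_erase_lt_of_mem (Finset.mem_univ j₀))
  rw [hdim] at hMh
  have hMh' : (vanishingIdeal K {b}).height = (Fintype.card ι : ℕ∞) := by exact_mod_cast hMh
  rw [hMh'] at hh
  exact absurd (by exact_mod_cast hh) (not_le.mpr hcard)

/-- A nonzero nilpotent matrix has a Jordan chain of length two. -/
theorem Matrix.exists_mulVec_ne_zero_of_isNilpotent {ι K : Type*} [Fintype ι] [DecidableEq ι]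
    [CommRing K] {N : Matrix ι ι K} (hN : IsNilpotent N) (h0 : N ≠ 0) :
    ∃ x : ι → K, N.mulVec x ≠ 0 ∧ N.mulVec (N.mulVec x) = 0 := by
  by_contra! H
  obtain ⟨k, hk⟩ := hN
  have key : ∀ j, N ^ (j + 1) = 0 → N = 0 := by
    intro j
    induction j with
    | zero => simp
    | succ j ih =>
      intro hj
      refine ih (Matrix.ext_of_mulVec_single fun i => ?_)
      by_contra hi
      rw [Matrix.zero_mulVec, pow_succ', ← Matrix.mulVec_mulVec] at hi
      refine H _ hi ?_
      rw [Matrix.mulVec_mulVec, Matrix.mulVec_mulVec, mul_assoc, ← pow_succ', ← pow_succ', hj,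
        Matrix.zero_mulVec]
  exact h0 (key k (by rw [pow_succ, hk, zero_mul]))

/-- The orbit of a vector under the powers of a unipotent matrix grows at most like the power of
the exponent one less than the nilpotency index. -/
theorem Matrix.tendsto_inv_pow_smul_pow_mulVec_of_unipotent {ι : Type*} [Fintype ι]
    [DecidableEq ι] {h : Matrix ι ι ℂ} {d m : ℕ} (hh : (h - 1) ^ d = 0) (hdm : d ≤ m)
    (z : ι → ℂ) :
    Filter.Tendsto (fun t : ℕ => ((t : ℂ) ^ m)⁻¹ • (h ^ t).mulVec z) Filter.atTop (nhds 0) := by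
  have hpow (t : ℕ) : h ^ t = ∑ i ∈ Finset.range d, (t.choose i : ℂ) • (h - 1) ^ i := by
    conv_lhs => rw [← sub_add_cancel h 1, (Commute.one_right (h - 1)).add_pow]
    have h1 : ∀ i, (h - 1) ^ i * 1 ^ (t - i) * (t.choose i : Matrix ι ι ℂ)
        = (t.choose i : ℂ) • (h - 1) ^ i := fun i => by
      rw [one_pow, mul_one, ← Nat.cast_commute, ← nsmul_eq_mul, Nat.cast_smul_eq_nsmul]
    simp only [h1]
    rcases le_total (t + 1) d with hle | hle
    · refine Finset.sum_subset (by simpa using hle) fun i _ hi => ?_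
      rw [Nat.choose_eq_zero_of_lt (by simpa using hi)]
      simp
    · refine (Finset.sum_subset (by simpa using hle) fun i _ hi => ?_).symm
      rw [pow_eq_zero_of_le (by simpa using hi) hh, smul_zero]
  have hlim (i : ℕ) (hi : i < m) :
      Filter.Tendsto (fun t : ℕ => ((t : ℂ) ^ m)⁻¹ * (t.choose i : ℂ)) Filter.atTop (nhds 0) := by
    have h1 : Filter.Tendsto (fun t : ℕ => (t : ℝ) ^ i / (t : ℝ) ^ m) Filter.atTop (nhds 0) :=
      (tendsto_pow_div_pow_atTop_zero hi).comp tendsto_natCast_atTop_atTop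
    refine squeeze_zero_norm (fun t => ?_) h1
    rw [norm_mul, norm_inv, norm_pow, Complex.norm_natCast, Complex.norm_natCast, div_eq_inv_mul]
    gcongr
    exact_mod_cast Nat.choose_le_pow t i
  have hsum : (fun t : ℕ => ((t : ℂ) ^ m)⁻¹ • (h ^ t).mulVec z) = fun t : ℕ =>
      ∑ i ∈ Finset.range d, (((t : ℂ) ^ m)⁻¹ * (t.choose i : ℂ)) • ((h - 1) ^ i).mulVec z := by
    funext t
    rw [hpow, Matrix.sum_mulVec, Finset.smul_sum]
    simp only [Matrix.smul_mulVec, smul_smul]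
  rw [hsum, show (0 : ι → ℂ) = ∑ i ∈ Finset.range d, (0 : ℂ) • ((h - 1) ^ i).mulVec z by simp]
  exact tendsto_finsetSum _ fun i hi =>
    (hlim i ((Finset.mem_range.mp hi).trans_le hdm)).smul_const _

/-- A unipotent matrix has no eigenvalue other than `1`. -/
theorem Matrix.eigenvalue_eq_one_of_unipotent {ι K : Type*} [Fintype ι] [DecidableEq ι]
    [Field K] {h : Matrix ι ι K} {d : ℕ} (hh : (h - 1) ^ d = 0) {z : ι → K} (hz : z ≠ 0) {ν : K}
    (hν : h.mulVec z = ν • z) : ν = 1 := by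
  have hp (k : ℕ) : ((h - 1) ^ k).mulVec z = (ν - 1) ^ k • z := by
    induction k with
    | zero => simp
    | succ k ih =>
      rw [pow_succ, ← Matrix.mulVec_mulVec, Matrix.sub_mulVec, hν, Matrix.one_mulVec,
        show ν • z - z = (ν - 1) • z by rw [sub_smul, one_smul], Matrix.mulVec_smul, ih, smul_smul,
        pow_succ']
  have := hp d
  rw [hh, Matrix.zero_mulVec, eq_comm, smul_eq_zero] at this
  exact sub_eq_zero.mp (eq_zero_of_pow_eq_zero (this.resolve_right hz))

/-- For `m > n+1`, no nontrivial unipotent element of `PGL_{n+1} × PGL_{n+1}`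
stabilizes a morphism `ℙⁿ → ℙⁿ` given by degree-`m` polynomials. -/
theorem unipotent_stabilizer_trivial
    (n m : ℕ) (hn : 1 ≤ n) (hm : n + 1 < m)
    (f : Fin (n + 1) → MvPolynomial (Fin (n + 1)) ℂ)
    (hhom : ∀ j, (f j).IsHomogeneous m)
    (hmor : ∀ x : Fin (n + 1) → ℂ, (∀ j, eval x (f j) = 0) → x = 0)
    (g h : Matrix (Fin (n + 1)) (Fin (n + 1)) ℂ)
    (hg : (g - 1) ^ (n + 1) = 0) (hh : (h - 1) ^ (n + 1) = 0)
    (μ : ℂ) (hμ : μ ≠ 0)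
    (hstab : ∀ j, aeval (fun i => ∑ k, C (g i k) * X k) (f j)
        = C μ * ∑ k, C (h j k) * f k) :
    g = 1 ∧ h = 1 := by
  set F : (Fin (n + 1) → ℂ) → Fin (n + 1) → ℂ := fun x j => eval x (f j) with hF
  have hFne (x : Fin (n + 1) → ℂ) (hx : x ≠ 0) : F x ≠ 0 := fun h0 =>
    hx (hmor x fun j => congrFun h0 j)
  have hFsmul (c : ℂ) (x : Fin (n + 1) → ℂ) : F (c • x) = c ^ m • F x := by
    funext j
    exact (hhom j).eval_smul_point c x
  have hFg (x : Fin (n + 1) → ℂ) : F (g.mulVec x) = μ • h.mulVec (F x) := by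
    funext j
    have := congrArg (eval x) (hstab j)
    have hcomp : eval x (aeval (fun i => ∑ k, C (g i k) * X k) (f j))
        = eval (g.mulVec x) (f j) := by
      simp only [aeval_def, algebraMap_eq, ← coe_eval₂Hom, ← RingHom.comp_apply]
      congr 1
      ext <;> simp [Matrix.mulVec, dotProduct]
    rw [hcomp] at this
    simpa [hF, Matrix.mulVec, dotProduct] using this
  have hμ1 : μ = 1 := by
    obtain ⟨v, hv, hgv⟩ : ∃ v, v ≠ 0 ∧ g.mulVec v = v := by
      by_cases h0 : g - 1 = 0
      · exact ⟨1, one_ne_zero, by rw [sub_eq_zero.mp h0, Matrix.one_mulVec]⟩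
      · obtain ⟨x, hx, hx'⟩ := Matrix.exists_mulVec_ne_zero_of_isNilpotent ⟨_, hg⟩ h0
        exact ⟨_, hx, by rwa [Matrix.sub_mulVec, Matrix.one_mulVec, sub_eq_zero] at hx'⟩
    have hv' := hFg v
    rw [hgv] at hv'
    refine inv_eq_one.mp (Matrix.eigenvalue_eq_one_of_unipotent hh (hFne v hv) ?_)
    rw [eq_inv_smul_iff₀ hμ, ← hv']
  subst hμ1
  simp only [one_smul] at hFg
  have hg1 : g = 1 := by
    by_contra hne
    obtain ⟨x, hx, hx'⟩ :=
      Matrix.exists_mulVec_ne_zero_of_isNilpotent ⟨_, hg⟩ (sub_ne_zero.mpr hne)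
    set v := (g - 1).mulVec x with hv
    have hgx : g.mulVec x = x + v := by
      rw [hv, Matrix.sub_mulVec, Matrix.one_mulVec, add_sub_cancel]
    have hgv : g.mulVec v = v := by
      rwa [Matrix.sub_mulVec, Matrix.one_mulVec, sub_eq_zero] at hx'
    have horb (t : ℕ) : F (x + (t : ℂ) • v) = (h ^ t).mulVec (F x) := by
      induction t with
      | zero => simp
      | succ t ih =>
        rw [pow_succ', ← Matrix.mulVec_mulVec, ← ih, ← hFg, Matrix.mulVec_add,
          Matrix.mulVec_smul, hgx, hgv]
        congr 1
        push_cast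
        module
    have hcont : Continuous F := continuous_pi fun j => (f j).continuous_eval
    have hinv : Filter.Tendsto (fun t : ℕ => (t : ℂ)⁻¹) Filter.atTop (nhds 0) :=
      tendsto_inv_atTop_nhds_zero_nat
    have hlim : Filter.Tendsto (fun t : ℕ => F ((t : ℂ)⁻¹ • x + v)) Filter.atTop
        (nhds (F v)) := by
      refine (hcont.tendsto v).comp ?_
      simpa using (hinv.smul_const x).add_const v
    refine hFne v hx (tendsto_nhds_unique hlim ?_)
    refine (Matrix.tendsto_inv_pow_smul_pow_mulVec_of_unipotent hh hm.le (F x)).congr' ?_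
    filter_upwards [Filter.eventually_gt_atTop 0] with t ht
    have ht' : (t : ℂ) ≠ 0 := by exact_mod_cast ht.ne'
    rw [← horb, ← inv_pow, ← hFsmul, smul_add, inv_smul_smul₀ ht']
  subst hg1
  refine ⟨rfl, ?_⟩
  have hli : LinearIndependent ℂ f := by
    refine linearIndependent_of_unique_zero f 0 fun x => ⟨hmor x, ?_⟩
    rintro rfl j
    simpa [show m ≠ 0 by omega] using (hhom j).eval_smul_point 0 0
  rw [Fintype.linearIndependent_iff] at hli
  refine Matrix.ext fun j k => sub_eq_zero.mp ?_
  refine hli (fun k => h j k - (1 : Matrix (Fin (n + 1)) (Fin (n + 1)) ℂ) j k) ?_ k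
  have hfix : f j = ∑ k, C (h j k) * f k := by
    refine MvPolynomial.funext fun x => ?_
    simpa [hF, Matrix.mulVec, dotProduct] using congrFun (hFg x) j
  simp only [sub_smul, Finset.sum_sub_distrib, Matrix.one_apply, ite_smul, one_smul, zero_smul,
    Finset.sum_ite_eq, Finset.mem_univ, if_true, smul_eq_C_mul]
  rw [← hfix, sub_self]
end

section
/- Let k be an algebraically closed field, n ≥ 1 and m ≥ 1 natural numbers, and f = (f_0, …, f_n) a tuple of nonzero homogeneous polynomials of degree m in the variables x_0, …, x_n over k. Let c = (c_0, …, c_n) and b = (b_0, …, b_n) be tuples of integers, and suppose that for every λ ∈ k^× there exists μ(λ) ∈ k^× such that for all j one has the polynomial identity f_j(λ^{c_0} x_0, …, λ^{c_n} x_n) = μ(λ) · λ^{b_j} · f_j(x_0, …, x_n). Then there exists an integer C such that for every j and every multi-index I = (i_0, …, i_n) for which the monomial x^I appears in f_j with nonzero coefficient, one has ⟨c, I⟩ − b_j = C, where ⟨c, I⟩ = Σ_{l=0}^{n} c_l i_l. (That is, if f is stabilized by the one-parameter diagonal subgroup g_{b,c}, then the Newton polyhedron of each f_j lies in the hyperplane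 Π_j = {I : ⟨c, I⟩ − b_j = C}.) -/
open MvPolynomial

/-- Rescaling the variables by `a` rescales the coefficient at `I` by `a ^ I`. -/
theorem MvPolynomial.coeff_aeval_C_mul_X {σ R : Type*} [Fintype σ] [CommSemiring R]
    (a : σ → R) (p : MvPolynomial σ R) (I : σ →₀ ℕ) :
    coeff I (aeval (fun i => C (a i) * X i) p) = (∏ i, a i ^ I i) * coeff I p := by
  classical
  induction p using MvPolynomial.induction_on' with
  | monomial J r =>
    have h : aeval (fun i => C (a i) * X i) (monomial J r) =
        monomial J (r * ∏ i, a i ^ J i) := by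
      rw [aeval_monomial, monomial_eq, Finsupp.prod_fintype _ _ (by simp),
        Finsupp.prod_fintype _ _ (by simp), algebraMap_eq, C_mul, map_prod, mul_assoc,
        ← Finset.prod_mul_distrib]
      simp [mul_pow]
    rw [h, coeff_monomial, coeff_monomial]
    split_ifs with hJ
    · rw [hJ, mul_comm]
    · simp
  | add p q hp hq => rw [map_add, coeff_add, coeff_add, hp, hq, mul_add]

/-- In an infinite field, no nonzero integer is an exponent of the group of units. -/
theorem Int.eq_zero_of_forall_units_zpow_eq_one {k : Type*} [Field k] [Infinite k] {d : ℤ}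
    (h : ∀ l : kˣ, l ^ d = 1) : d = 0 := by
  by_contra hd
  have hpos : 0 < d.natAbs := Int.natAbs_pos.mpr hd
  have hnat (l : kˣ) : l ^ d.natAbs = 1 := pow_natAbs_eq_one.mpr (h l)
  have hzero : (Polynomial.X * (Polynomial.X ^ d.natAbs - Polynomial.C 1) : Polynomial k) = 0 := by
    refine Polynomial.funext fun x => ?_
    rcases eq_or_ne x 0 with rfl | hx
    · simp
    · have hl : x ^ d.natAbs = 1 := by simpa using congrArg Units.val (hnat (Units.mk0 x hx))
      simp [hl]
  exact mul_ne_zero Polynomial.X_ne_zero (Polynomial.X_pow_sub_C_ne_zero hpos 1) hzero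

/-- If a tuple `f` of nonzero degree-`m` forms is stabilized (up to scalar) by the
one-parameter diagonal subgroup `g_{b,c}`, then there is a constant `C` such that
the support of each `f j` lies in the hyperplane `⟨c, I⟩ - b j = C`. -/
theorem newton_polyhedron_in_hyperplane
    {k : Type*} [Field k] [IsAlgClosed k]
    (n m : ℕ) (hn : 1 ≤ n) (hm : 1 ≤ m)
    (f : Fin (n + 1) → MvPolynomial (Fin (n + 1)) k)
    (hne : ∀ j, f j ≠ 0)
    (hhom : ∀ j, (f j).IsHomogeneous m)
    (c b : Fin (n + 1) → ℤ)
    (hstab : ∀ l : kˣ, ∃ μ : kˣ,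
      ∀ j, aeval (fun i => C ((l ^ c i : kˣ) : k) * X i) (f j)
        = C ((μ * l ^ b j : kˣ) : k) * f j) :
    ∃ C : ℤ, ∀ j, ∀ I : Fin (n + 1) →₀ ℕ,
      coeff I (f j) ≠ 0 → (∑ l, c l * (I l : ℤ)) - b j = C := by
  have key (l : kˣ) : ∃ μ : kˣ, ∀ j I, coeff I (f j) ≠ 0 →
      l ^ ((∑ i, c i * (I i : ℤ)) - b j) = μ := by
    obtain ⟨μ, hμ⟩ := hstab l
    refine ⟨μ, fun j I hI => ?_⟩
    have h := congrArg (coeff I) (hμ j)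
    rw [coeff_aeval_C_mul_X, coeff_C_mul] at h
    have hprod : ∏ i, (l ^ c i) ^ I i = μ * l ^ b j := by
      ext
      simpa using mul_right_cancel₀ hI h
    have hsum : l ^ (∑ i, c i * (I i : ℤ)) = ∏ i, (l ^ c i) ^ I i := by
      have hs := map_sum (zmultiplesHom (Additive kˣ) (Additive.ofMul l))
        (fun i => c i * (I i : ℤ)) Finset.univ
      have hs' : l ^ (∑ i, c i * (I i : ℤ)) = ∏ i, l ^ (c i * (I i : ℤ)) := hs
      simpa [zpow_mul] using hs'
    rw [zpow_sub, hsum, hprod, mul_inv_cancel_right]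
  obtain ⟨J, hJ⟩ := ne_zero_iff.mp (hne 0)
  have : Infinite k := IsAlgClosed.instInfinite
  refine ⟨(∑ l, c l * (J l : ℤ)) - b 0, fun j I hI => sub_eq_zero.mp ?_⟩
  refine Int.eq_zero_of_forall_units_zpow_eq_one (k := k) fun l => ?_
  obtain ⟨μ, hμ⟩ := key l
  rw [zpow_sub, hμ j I hI, hμ 0 J hJ, mul_inv_cancel]
end

section
/- Let k be a field, n ≥ 1 and m ≥ 1 natural numbers, and f = (f_0, …, f_n) a tuple of homogeneous polynomials of degree m in the variables x_0, …, x_n over k whose only common zero in k^{n+1} is the origin. Let c = (c_0, …, c_n), b = (b_0, …, b_n) be integer vectors and C an integer such that for every j and every multi-index I for which x^I appears in f_j with nonzero coefficient one has ⟨c, I⟩ − b_j = C. Then for every index i ∈ {0, …, n} there exists an index j ∈ {0, …, n} with m·c_i − b_j = C. (Every vertex p_i = m·e_i of the simplex Δ lies on one of the hyperplanes Π_j = {I : ⟨c, I⟩ − b_j = C}; equivalently, for each i some f_j contains the monomial x_i^m.) -/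
open MvPolynomial

/-- A homogeneous polynomial of degree `m` not vanishing at the `i`-th coordinate point
contains the monomial `x_i ^ m`. -/
theorem coeff_single_ne_zero_of_eval_single_ne_zero
    {σ R : Type*} [Fintype σ] [DecidableEq σ] [CommSemiring R] {m : ℕ} {p : MvPolynomial σ R}
    (hp : p.IsHomogeneous m) {i : σ} (h : eval (Pi.single i 1) p ≠ 0) :
    coeff (Finsupp.single i m) p ≠ 0 := by
  rw [eval_eq'] at h
  obtain ⟨I, hI, hne⟩ := Finset.exists_ne_zero_of_sum_ne_zero h
  have hcoeff : coeff I p ≠ 0 := mem_support_iff.mp hI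
  have hoff : ∀ l, l ≠ i → I l = 0 := by
    intro l hl
    by_contra h0
    exact hne (by rw [Finset.prod_eq_zero (Finset.mem_univ l) (by simp [hl, h0]), mul_zero])
  have hsingle : I = Finsupp.single i (I i) := by
    ext l
    by_cases hl : l = i
    · simp [hl]
    · simp [hoff l hl, Ne.symm hl]
  have hdeg : I.degree = m := by
    rw [Finsupp.degree_eq_weight_one]
    exact hp hcoeff
  rw [hsingle, Finsupp.degree_single] at hdeg
  rwa [← hdeg, ← hsingle]

/-- Every vertex `p_i = m·e_i` of the simplex `Δ` lies on one of the hyperplanes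
`Π_j = {I : ⟨c, I⟩ - b j = C}`: for each `i` some `f j` contains the monomial `x_i ^ m`. -/
theorem vertex_in_hyperplane
    {k : Type*} [Field k]
    (n m : ℕ) (hn : 1 ≤ n) (hm : 1 ≤ m)
    (f : Fin (n + 1) → MvPolynomial (Fin (n + 1)) k)
    (hhom : ∀ j, (f j).IsHomogeneous m)
    (hmor : ∀ x : Fin (n + 1) → k, (∀ j, eval x (f j) = 0) → x = 0)
    (c b : Fin (n + 1) → ℤ) (C : ℤ)
    (hplane : ∀ j, ∀ I : Fin (n + 1) →₀ ℕ,
      coeff I (f j) ≠ 0 → (∑ l, c l * (I l : ℤ)) - b j = C) :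
    ∀ i : Fin (n + 1), ∃ j : Fin (n + 1), (m : ℤ) * c i - b j = C := by
  intro i
  obtain ⟨j, hj⟩ : ∃ j, eval (Pi.single i 1) (f j) ≠ 0 := by
    by_contra! h
    simpa using congrFun (hmor _ h) i
  refine ⟨j, ?_⟩
  have h := hplane j _ (coeff_single_ne_zero_of_eval_single_ne_zero (hhom j) hj)
  rw [Finset.sum_eq_single i (fun l _ hl => by simp [Ne.symm hl]) (by simp)] at h
  simpa [mul_comm] using h
end

section
/- Let k be an algebraically closed field, n ≥ 1 and m ≥ 1 natural numbers, and f = (f_0, …, f_n) a tuple of nonzero homogeneous polynomials of degree m in x_0, …, x_n over k whose only common zero in k^{n+1} is the origin. Let c, b be integer vectors of length n+1 and C an integer such that for every j and every multi-index I with x^I appearing in f_j with nonzero coefficient one has ⟨c, I⟩ − b_j = C. Then for every integer β, the number of indices j ∈ {0, …, n} with b_j = β equals the number of indices i ∈ {0, …, n} with m·c_i = C + β. (Each hyperplane Π_j = {I : ⟨c,I⟩ = C + b_j} contains some vertex of the simplex Δ, and a hyperplane repeated exactly k+1 times among the Π_j contains exactly k+1 vertices of Δ.) -/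
open MvPolynomial

/-- Finitely many polynomials over an algebraically closed field whose only common zero is the
origin are at least as many as the variables. -/
theorem card_le_card_of_forall_eval_eq_zero_iff {k σ : Type*} [Field k] [IsAlgClosed k] [Finite σ]
    (s : Finset (MvPolynomial σ k))
    (hs : ∀ x : σ → k, (∀ p ∈ s, eval x p = 0) ↔ x = 0) :
    Nat.card σ ≤ s.card := by
  classical
  have hdim : ringKrullDim (MvPolynomial σ k) = Nat.card σ := by
    simp [MvPolynomial.ringKrullDim_of_isNoetherianRing]
  have : FiniteRingKrullDim (MvPolynomial σ k) := by
    rw [finiteRingKrullDim_iff_ne_bot_and_top, hdim]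
    exact ⟨WithBot.coe_ne_bot, WithBot.coe_injective.ne (ENat.natCast_ne_top _)⟩
  obtain ⟨M, hM, hht⟩ := Ideal.exists_isMaximal_height (R := MvPolynomial σ k)
  obtain ⟨a, rfl⟩ := eq_vanishingIdeal_singleton_of_isMaximal k hM
  let τ : MvPolynomial σ k →ₐ[k] MvPolynomial σ k := aeval fun i => X i - C (a i)
  have hτ (x : σ → k) (p : MvPolynomial σ k) : eval x (τ p) = eval (x - a) p := by
    change eval x (aeval _ p) = _
    rw [aeval_def, eval_eval₂]
    simp only [eval, algebraMap_eq, eval₂Hom_comp_C, coe_eval₂Hom, eval₂_sub, eval₂_X, eval₂_C]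
    congr 1
  have hzero : zeroLocus k (Ideal.span (s.image τ : Set (MvPolynomial σ k))) = {a} := by
    rw [zeroLocus_span]
    ext x
    simp [hτ, hs, sub_eq_zero, aeval_eq_eval]
  have hmin : vanishingIdeal k {a} ∈
      (Ideal.span (s.image τ : Set (MvPolynomial σ k))).minimalPrimes := by
    rw [← Ideal.radical_minimalPrimes, ← vanishingIdeal_zeroLocus_eq_radical (K := k), hzero,
      Ideal.minimalPrimes_eq_subsingleton_self]
    rfl
  have hle := Ideal.height_le_card_of_mem_minimalPrimes_span_finset hmin
  have hcard : (Nat.card σ : ℕ∞) ≤ (s.image τ).card := by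
    rw [hdim] at hht
    rwa [show ((vanishingIdeal k {a}).height = Nat.card σ) from WithBot.coe_injective hht] at hle
  exact (Nat.cast_le.mp hcard).trans Finset.card_image_le

/-- A polynomial that does not vanish at a point has a monomial that involves only variables not
vanishing there. -/
theorem exists_coeff_ne_zero_of_eval_ne_zero {k σ : Type*} [Field k]
    {p : MvPolynomial σ k} {x : σ → k} (h : eval x p ≠ 0) :
    ∃ I : σ →₀ ℕ, coeff I p ≠ 0 ∧ ∀ i, x i = 0 → I i = 0 := by
  rw [eval_eq] at h
  obtain ⟨I, hI, hne⟩ := Finset.exists_ne_zero_of_sum_ne_zero h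
  refine ⟨I, mem_support_iff.mp hI, fun i hi => ?_⟩
  by_contra hIi
  exact right_ne_zero_of_mul hne
    (Finset.prod_eq_zero (Finsupp.mem_support_iff.mpr hIi) (by simp [hi, hIi]))

/-- A hyperplane occurs among the `Π_j` at least as often as it contains vertices of `Δ`. -/
theorem card_vertices_le_card_hyperplanes {k ι : Type*} [Field k] [IsAlgClosed k] [Fintype ι]
    {m : ℕ} (hm : m ≠ 0) {f : ι → MvPolynomial ι k} (hhom : ∀ j, (f j).IsHomogeneous m)
    (hmor : ∀ x : ι → k, (∀ j, eval x (f j) = 0) → x = 0) {c b : ι → ℤ} {C : ℤ}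
    (hplane : ∀ j, ∀ I : ι →₀ ℕ, coeff I (f j) ≠ 0 → (∑ l, c l * (I l : ℤ)) - b j = C) (β : ℤ) :
    (Finset.univ.filter fun i => (m : ℤ) * c i = C + β).card
      ≤ (Finset.univ.filter fun j => b j = β).card := by
  classical
  have hdeg {j : ι} {I : ι →₀ ℕ} (hI : coeff I (f j) ≠ 0) : ∑ l, I l = m := by
    rw [← Finsupp.degree_eq_sum]
    by_contra h
    exact hI ((hhom j).coeff_eq_zero h)
  set s : Finset (MvPolynomial ι k) :=
    (Finset.univ.filter fun i => ¬ (m : ℤ) * c i = C + β).image X ∪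
      (Finset.univ.filter fun j => b j = β).image f
  have hzero (x : ι → k) : (∀ p ∈ s, eval x p = 0) ↔ x = 0 := by
    constructor
    · intro h
      refine hmor x fun j => ?_
      by_contra hj
      obtain ⟨I, hI, hsupp⟩ := exists_coeff_ne_zero_of_eval_ne_zero hj
      refine hj (h _ (Finset.mem_union_right _ (Finset.mem_image_of_mem _ ?_)))
      have hsum : (m : ℤ) * ∑ l, c l * (I l : ℤ) = m * (C + β) := by
        have hdegI : (m : ℤ) = ∑ l, (I l : ℤ) := mod_cast (hdeg hI).symm
        rw [mul_comm _ (C + β), Finset.mul_sum]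
        conv_rhs => rw [hdegI, Finset.mul_sum]
        refine Finset.sum_congr rfl fun l _ => ?_
        by_cases hl : (m : ℤ) * c l = C + β
        · rw [← mul_assoc, hl]
        · have hx : x l = 0 := by
            simpa using h (X l) (Finset.mem_union_left _ (Finset.mem_image_of_mem _ (by simpa)))
          simp [hsupp l hx]
      have := mul_left_cancel₀ (Nat.cast_ne_zero.mpr hm) hsum
      have := hplane j I hI
      simp only [Finset.mem_filter, Finset.mem_univ, true_and]
      linarith
    · rintro rfl p hp
      obtain hp | hp := Finset.mem_union.mp hp <;> obtain ⟨i, -, rfl⟩ := Finset.mem_image.mp hp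
      · simp
      · by_contra hi
        obtain ⟨I, hI, hsupp⟩ := exists_coeff_ne_zero_of_eval_ne_zero hi
        exact hm ((hdeg hI).symm.trans (Finset.sum_eq_zero fun l _ => hsupp l rfl))
  have hle := card_le_card_of_forall_eval_eq_zero_iff s hzero
  have hcard : s.card ≤ _ := (Finset.card_union_le _ _).trans
    (add_le_add Finset.card_image_le Finset.card_image_le)
  have hsplit := Finset.card_filter_add_card_filter_not (s := (Finset.univ : Finset ι))
    (fun i => (m : ℤ) * c i = C + β)
  rw [Nat.card_eq_fintype_card, ← Finset.card_univ] at hle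
  omega

/-- Each hyperplane `Π_j` contains a vertex of `Δ`; a hyperplane repeated exactly
`k+1` times among the `Π_j` contains exactly `k+1` vertices of `Δ`.  Equivalently,
for each `β` the number of `j` with `b j = β` equals the number of `i` with
`m·c i = C + β`. -/
theorem hyperplane_vertex_count
    {k : Type*} [Field k] [IsAlgClosed k]
    (n m : ℕ) (hn : 1 ≤ n) (hm : 1 ≤ m)
    (f : Fin (n + 1) → MvPolynomial (Fin (n + 1)) k)
    (hne : ∀ j, f j ≠ 0)
    (hhom : ∀ j, (f j).IsHomogeneous m)
    (hmor : ∀ x : Fin (n + 1) → k, (∀ j, eval x (f j) = 0) → x = 0)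
    (c b : Fin (n + 1) → ℤ) (C : ℤ)
    (hplane : ∀ j, ∀ I : Fin (n + 1) →₀ ℕ,
      coeff I (f j) ≠ 0 → (∑ l, c l * (I l : ℤ)) - b j = C) :
    ∀ β : ℤ,
      (Finset.univ.filter fun j : Fin (n + 1) => b j = β).card
        = (Finset.univ.filter fun i : Fin (n + 1) => (m : ℤ) * c i = C + β).card := by
  intro β
  let T : Finset ℤ := insert β
    (Finset.univ.image b ∪ Finset.univ.image fun i => (m : ℤ) * c i - C)
  have hle (γ : ℤ) := card_vertices_le_card_hyperplanes (by omega) hhom hmor hplane γ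
  have hb : (Finset.univ : Finset (Fin (n + 1))).card =
      ∑ γ ∈ T, (Finset.univ.filter fun j => b j = γ).card :=
    Finset.card_eq_sum_card_fiberwise fun j _ => by simp [T]
  have hc : (Finset.univ : Finset (Fin (n + 1))).card =
      ∑ γ ∈ T, (Finset.univ.filter fun i => (m : ℤ) * c i - C = γ).card :=
    Finset.card_eq_sum_card_fiberwise fun i _ => Finset.mem_insert_of_mem (Finset.mem_union_right _
      (Finset.mem_image_of_mem _ (Finset.mem_univ i)))
  simp only [sub_eq_iff_eq_add'] at hc
  exact ((Finset.sum_eq_sum_iff_of_le fun γ _ => hle γ).mp (hc.symm.trans hb) β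
    (Finset.mem_insert_self _ _)).symm
end

section
/- Let k be an algebraically closed field, n ≥ 1 and m ≥ 1 natural numbers, and f = (f_0, …, f_n) a tuple of nonzero homogeneous polynomials of degree m in x_0, …, x_n over k whose only common zero in k^{n+1} is the origin. Suppose there are integer vectors c = (c_0, …, c_n) and b = (b_0, …, b_n) with c not constant, and an integer C, such that for every j and every multi-index I with x^I appearing in f_j with nonzero coefficient one has ⟨c, I⟩ − b_j = C. Then there exist subsets S, T ⊆ {0, …, n} with S and T nonempty, |S| = |T| ≤ n, such that for every j ∈ T, every monomial appearing in f_j with nonzero coefficient involves only the variables x_i with i ∈ S (i.e. every exponent vector I in the support of f_j satisfies I_i = 0 for all i ∉ S). -/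
open MvPolynomial

/-- The prime ideal of polynomials vanishing on the coordinate subspace `x i = 0`, `i ∈ t`,
has height at least `|t|`. -/
lemma card_le_height_ker_coordinateSubspace {k σ : Type*} [Field k] [Finite σ] [DecidableEq σ]
    (t : Finset σ) :
    (t.card : ℕ∞) ≤ (RingHom.ker (aeval (R := k)
      (fun i => if i ∈ t then (0 : MvPolynomial σ k) else X i))).height := by
  induction t using Finset.induction_on with
  | empty => simp
  | insert a t ha ih =>
    set φ := aeval (R := k) (fun i => if i ∈ t then (0 : MvPolynomial σ k) else X i)
    set ψ := aeval (R := k) (fun i => if i ∈ insert a t then (0 : MvPolynomial σ k) else X i)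
      with hψ
    have hψφ : ψ = ψ.comp φ := by
      ext1 i
      by_cases hi : i ∈ t <;> simp [φ, ψ, hi]
    have : (RingHom.ker φ).IsPrime := RingHom.ker_isPrime φ
    have hlt : RingHom.ker φ < RingHom.ker ψ := by
      refine lt_of_le_of_ne (fun p hp => ?_) (fun h => ?_)
      · rw [RingHom.mem_ker] at hp ⊢
        rw [hψφ, AlgHom.comp_apply, hp, map_zero]
      · have hX : X a ∈ RingHom.ker φ := by
          rw [h, RingHom.mem_ker]
          simp [ψ]
        rw [RingHom.mem_ker] at hX
        simp [φ, ha] at hX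
    have hprime : (RingHom.ker ψ).IsPrime := RingHom.ker_isPrime ψ
    rw [Finset.card_insert_of_notMem ha, Nat.cast_add, Nat.cast_one]
    exact (add_le_add_left ih 1).trans
      (Order.add_one_le_of_lt (Ideal.height_strict_mono_of_isPrime_of_isPrime hlt))

/-- Polynomials over an algebraically closed field whose only common zero is the origin
are at least as many as the variables. -/
lemma card_le_card_of_common_zero_eq_origin {k σ : Type*} [Field k] [IsAlgClosed k] [Fintype σ]
    (s : Finset (MvPolynomial σ k))
    (hs : ∀ x : σ → k, (∀ p ∈ s, eval x p = 0) ↔ x = 0) :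
    Fintype.card σ ≤ s.card := by
  classical
  have hloc : zeroLocus k (Ideal.span (s : Set (MvPolynomial σ k))) = {0} := by
    ext x
    simpa [zeroLocus_span, aeval_eq_eval] using hs x
  have hmin : vanishingIdeal k {(0 : σ → k)} ∈
      (Ideal.span (s : Set (MvPolynomial σ k))).minimalPrimes := by
    have hrad := vanishingIdeal_zeroLocus_eq_radical (k := k) (K := k)
      (Ideal.span (s : Set (MvPolynomial σ k)))
    rw [hloc] at hrad
    rw [← Ideal.radical_minimalPrimes, ← hrad, Ideal.minimalPrimes_eq_subsingleton_self]
    rfl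
  have hheight := card_le_height_ker_coordinateSubspace (k := k) (Finset.univ : Finset σ)
  have hle : RingHom.ker (aeval (R := k)
      (fun i => if i ∈ (Finset.univ : Finset σ) then (0 : MvPolynomial σ k) else X i)) ≤
      vanishingIdeal k {(0 : σ → k)} := by
    intro p hp
    rw [RingHom.mem_ker] at hp
    rw [mem_vanishingIdeal_singleton_iff]
    have hcomp : (aeval (0 : σ → k)).comp (aeval (R := k)
        (fun i => if i ∈ (Finset.univ : Finset σ) then (0 : MvPolynomial σ k) else X i)) =
        aeval (0 : σ → k) := by
      ext i
      simp
    rw [← hcomp, AlgHom.comp_apply, hp, map_zero]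
  exact_mod_cast (hheight.trans (Ideal.height_mono hle)).trans
    (Ideal.height_le_card_of_mem_minimalPrimes_span_finset hmin)

/-- If the `f j` have no common zero except the origin and all `f j` with `j ∉ T` vanish on the
coordinate subspace spanned by `S`, then `|S| ≤ |T|`. -/
lemma card_le_card_of_eval_eq_zero {k σ ι : Type*} [Field k] [IsAlgClosed k] [Fintype σ]
    (f : ι → MvPolynomial σ k) (h0 : ∀ j, eval 0 (f j) = 0)
    (hf : ∀ x : σ → k, (∀ j, eval x (f j) = 0) → x = 0) (S : Finset σ) (T : Finset ι)
    (hST : ∀ j ∉ T, ∀ x : σ → k, (∀ i ∉ S, x i = 0) → eval x (f j) = 0) :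
    S.card ≤ T.card := by
  classical
  have h := card_le_card_of_common_zero_eq_origin (T.image f ∪ Sᶜ.image X) (fun x => ?_)
  · have h1 := Finset.card_union_le (T.image f) (Sᶜ.image (X (R := k)))
    have h2 := Finset.card_image_le (s := T) (f := f)
    have h3 := Finset.card_image_le (s := Sᶜ) (f := X (R := k))
    have h4 := Finset.card_add_card_compl S
    omega
  · refine ⟨fun hx => hf x fun j => ?_, ?_⟩
    · by_cases hj : j ∈ T
      · exact hx _ (Finset.mem_union_left _ (Finset.mem_image_of_mem f hj))
      · refine hST j hj x fun i hi => ?_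
        simpa using hx (X i) (Finset.mem_union_right _
          (Finset.mem_image_of_mem X (Finset.mem_compl.2 hi)))
    · rintro rfl p hp
      rcases Finset.mem_union.1 hp with hp | hp
      · obtain ⟨j, -, rfl⟩ := Finset.mem_image.1 hp
        exact h0 j
      · obtain ⟨i, -, rfl⟩ := Finset.mem_image.1 hp
        simp

/-- The weight of a degree `m` exponent vector is at most `m * M`, where `M` bounds the weights of
the variables, with equality exactly when only variables of weight `M` occur. -/
lemma weight_eq_degree_mul_iff {σ : Type*} [Fintype σ] (c : σ → ℤ) (M : ℤ)
    (hM : ∀ i, c i ≤ M) (I : σ →₀ ℕ) :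
    ∑ l, c l * (I l : ℤ) = I.degree * M ↔ ∀ i, c i ≠ M → I i = 0 := by
  have hdeg : (I.degree : ℤ) * M = ∑ l, M * (I l : ℤ) := by
    rw [Finsupp.degree_eq_sum, Nat.cast_sum, Finset.sum_mul]
    exact Finset.sum_congr rfl fun _ _ => mul_comm _ _
  rw [hdeg, Finset.sum_eq_sum_iff_of_le
    fun i _ => mul_le_mul_of_nonneg_right (hM i) (Int.natCast_nonneg _)]
  refine forall_congr' fun i => ?_
  simp [or_iff_not_imp_left]

/-- Structure of morphisms `ℙⁿ → ℙⁿ` with infinite stabilizer: if the support of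
each `f j` lies in a hyperplane `⟨c, I⟩ - b j = C` with `c` nonconstant, then there
are nonempty sets `S`, `T` of indices with `|S| = |T| ≤ n` such that for `j ∈ T`
the polynomial `f j` involves only the variables indexed by `S`. -/
theorem infinite_stabilizer_structure
    {k : Type*} [Field k] [IsAlgClosed k]
    (n m : ℕ) (hn : 1 ≤ n) (hm : 1 ≤ m)
    (f : Fin (n + 1) → MvPolynomial (Fin (n + 1)) k)
    (hne : ∀ j, f j ≠ 0)
    (hhom : ∀ j, (f j).IsHomogeneous m)
    (hmor : ∀ x : Fin (n + 1) → k, (∀ j, eval x (f j) = 0) → x = 0)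
    (c b : Fin (n + 1) → ℤ) (hc : ∃ i i' : Fin (n + 1), c i ≠ c i') (C : ℤ)
    (hplane : ∀ j, ∀ I : Fin (n + 1) →₀ ℕ,
      coeff I (f j) ≠ 0 → (∑ l, c l * (I l : ℤ)) - b j = C) :
    ∃ S T : Finset (Fin (n + 1)), S.Nonempty ∧ T.Nonempty ∧
      S.card = T.card ∧ S.card ≤ n ∧
      ∀ j ∈ T, ∀ I : Fin (n + 1) →₀ ℕ,
        coeff I (f j) ≠ 0 → ∀ i ∉ S, I i = 0 := by
  obtain ⟨i₀, hi₀⟩ := Finite.exists_max c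
  let S : Finset (Fin (n + 1)) := {i | c i = c i₀}
  let T : Finset (Fin (n + 1)) := {j | C + b j = m * c i₀}
  have hdegree : ∀ j I, coeff I (f j) ≠ 0 → I.degree = m := fun j I hI => by
    rw [Finsupp.degree_eq_weight_one]
    exact hhom j hI
  have hS : S.Nonempty := ⟨i₀, by simp [S]⟩
  have hSn : S.card ≤ n := by
    obtain ⟨i, hi⟩ : ∃ i, c i ≠ c i₀ := by
      obtain ⟨i, i', h⟩ := hc
      by_contra! hall
      exact h ((hall i).trans (hall i').symm)
    have hlt : S.card < Fintype.card (Fin (n + 1)) :=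
      Finset.card_lt_univ_of_notMem (x := i) (by simpa [S] using hi)
    simpa [Nat.lt_succ_iff] using hlt
  have hST : S.card ≤ T.card := by
    refine card_le_card_of_eval_eq_zero f (fun j => ?_) hmor S T fun j hj x hx => ?_
    · rw [eval_zero, constantCoeff_eq]
      exact (hhom j).coeff_eq_zero (by rw [map_zero]; omega)
    · rw [eval_eq']
      refine Finset.sum_eq_zero fun I hI => ?_
      have hI := mem_support_iff.1 hI
      have hweight : ¬ ∀ i, c i ≠ c i₀ → I i = 0 := fun h => hj <| by
        have h1 := (weight_eq_degree_mul_iff c (c i₀) hi₀ I).2 h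
        rw [hdegree j I hI] at h1
        simpa [T] using by linarith [hplane j I hI]
      push Not at hweight
      obtain ⟨i, hi, hIi⟩ := hweight
      rw [Finset.prod_eq_zero (Finset.mem_univ i), mul_zero]
      rw [hx i (by simpa [S] using hi), zero_pow hIi]
  obtain ⟨T', hT'T, hT'⟩ := Finset.exists_subset_card_eq hST
  refine ⟨S, T', hS, Finset.card_pos.1 (hT' ▸ hS.card_pos), hT'.symm, hSn, ?_⟩
  intro j hj I hI i hi
  have hjT : C + b j = m * c i₀ := by simpa [T] using hT'T hj
  refine (weight_eq_degree_mul_iff c (c i₀) hi₀ I).1 ?_ i (by simpa [S] using hi)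
  rw [hdegree j I hI]
  linarith [hplane j I hI]
end

section
/- Let k be an algebraically closed field, n ≥ 1 and m ≥ 1 natural numbers, and f = (f_0, …, f_n) a tuple of nonzero homogeneous polynomials of degree m in x_0, …, x_n over k whose only common zero in k^{n+1} is the origin. Suppose there are integer vectors c = (c_0, …, c_n) (not constant) and b = (b_0, …, b_n) and an integer K such that for every j and every multi-index I with x^I appearing in f_j with nonzero coefficient one has ⟨c, I⟩ − b_j ≥ K. Define the initial form \bar f_j as the sum of those monomials a_{j,I} x^I of f_j with ⟨c, I⟩ − b_j = K, and suppose that the tuple \bar f = (\bar f_0, …, \bar f_n) again consists of nonzero polynomials whose only common zero in k^{n+1} is the origin. Then there exist nonempty subsets S, T ⊆ {0, …, n} with |S| = |T| ≤ n such that for every j ∈ T, every monomial appearing in f_j with nonzero coefficient involves only the variables x_i with i ∈ S. -/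
open MvPolynomial

section ZeroLocus

variable {k σ : Type*} [Field k] [IsAlgClosed k] [Finite σ]

/-- Over an algebraically closed field, the ideal of a point of affine space has height equal to
the dimension of the space. -/
theorem MvPolynomial.height_vanishingIdeal_singleton (x : σ → k) :
    (vanishingIdeal k {x}).height = Nat.card σ := by
  have hdim : ringKrullDim (MvPolynomial σ k) = Nat.card σ := by
    rw [MvPolynomial.ringKrullDim_of_isNoetherianRing, ringKrullDim_eq_zero_of_field, zero_add]
  have : FiniteRingKrullDim (MvPolynomial σ k) :=
    finiteRingKrullDim_iff_ne_bot_and_top.mpr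
      ⟨by rw [hdim]; exact WithBot.coe_ne_bot,
        by rw [hdim]; exact fun h ↦ ENat.natCast_ne_top (Nat.card σ) (WithBot.coe_injective h)⟩
  obtain ⟨p, hp, hpd⟩ := Ideal.exists_isMaximal_height (R := MvPolynomial σ k)
  obtain ⟨y, rfl⟩ := eq_vanishingIdeal_singleton_of_isMaximal k hp
  let e : MvPolynomial σ k ≃ₐ[k] MvPolynomial σ k :=
    AlgEquiv.ofAlgHom (aeval fun i ↦ X i + C (y i - x i)) (aeval fun i ↦ X i + C (x i - y i))
      (by ext1 i; simp [add_assoc])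
      (by ext1 i; simp [add_assoc])
  have hcomap : (vanishingIdeal k {x}).comap e.toRingEquiv = vanishingIdeal k {y} := by
    ext p
    have hcomp : (aeval x).comp (e : MvPolynomial σ k →ₐ[k] MvPolynomial σ k) = aeval y := by
      ext i
      simp [e]
    rw [Ideal.mem_comap, mem_vanishingIdeal_singleton_iff, mem_vanishingIdeal_singleton_iff,
      ← hcomp]
    rfl
  rw [← e.toRingEquiv.height_comap, hcomap]
  rw [hdim] at hpd
  exact_mod_cast hpd

/-- An isolated point of affine space cut out by a finite set of polynomials requires at least as
many polynomials as the dimension of the space. -/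
theorem MvPolynomial.card_le_card_of_zeroLocus_span_eq_singleton
    (s : Finset (MvPolynomial σ k)) (x : σ → k)
    (hs : zeroLocus k (Ideal.span (s : Set (MvPolynomial σ k))) = {x}) :
    Nat.card σ ≤ s.card := by
  have hrad : (Ideal.span (s : Set (MvPolynomial σ k))).radical = vanishingIdeal k {x} := by
    rw [← vanishingIdeal_zeroLocus_eq_radical (K := k), hs]
  have hmin : vanishingIdeal k {x} ∈
      (Ideal.span (s : Set (MvPolynomial σ k))).minimalPrimes := by
    rw [← Ideal.radical_minimalPrimes, hrad, Ideal.minimalPrimes_eq_subsingleton_self]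
    rfl
  have := Ideal.height_le_card_of_mem_minimalPrimes_span_finset hmin
  rw [height_vanishingIdeal_singleton] at this
  exact_mod_cast this

end ZeroLocus

/-- Structure of unstable morphisms `ℙⁿ → ℙⁿ`: if the support of each `f j` lies
in the half-space `⟨c, I⟩ - b j ≥ K` (with `c` nonconstant) and the initial-form
limit `f̄` is again a morphism, then there are nonempty sets `S`, `T` with
`|S| = |T| ≤ n` such that for `j ∈ T` the polynomial `f j` involves only the
variables indexed by `S`. -/
theorem unstable_morphism_structure
    {k : Type*} [Field k] [IsAlgClosed k]
    (n m : ℕ) (hn : 1 ≤ n) (hm : 1 ≤ m)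
    (f : Fin (n + 1) → MvPolynomial (Fin (n + 1)) k)
    (hne : ∀ j, f j ≠ 0)
    (hhom : ∀ j, (f j).IsHomogeneous m)
    (hmor : ∀ x : Fin (n + 1) → k, (∀ j, eval x (f j) = 0) → x = 0)
    (c b : Fin (n + 1) → ℤ) (hc : ∃ i i' : Fin (n + 1), c i ≠ c i') (K : ℤ)
    (hhalf : ∀ j, ∀ I : Fin (n + 1) →₀ ℕ,
      coeff I (f j) ≠ 0 → K ≤ (∑ l, c l * (I l : ℤ)) - b j)
    (fbar : Fin (n + 1) → MvPolynomial (Fin (n + 1)) k)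
    (hfbar : ∀ j, ∀ I : Fin (n + 1) →₀ ℕ,
      coeff I (fbar j) =
        if (∑ l, c l * (I l : ℤ)) - b j = K then coeff I (f j) else 0)
    (hbarne : ∀ j, fbar j ≠ 0)
    (hbarmor : ∀ x : Fin (n + 1) → k, (∀ j, eval x (fbar j) = 0) → x = 0) :
    ∃ S T : Finset (Fin (n + 1)), S.Nonempty ∧ T.Nonempty ∧
      S.card = T.card ∧ S.card ≤ n ∧
      ∀ j ∈ T, ∀ I : Fin (n + 1) →₀ ℕ,
        coeff I (f j) ≠ 0 → ∀ i ∉ S, I i = 0 := by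
  obtain ⟨i₀, -, hi₀⟩ := Finset.exists_max_image Finset.univ c ⟨0, Finset.mem_univ _⟩
  set M := c i₀
  let S : Finset (Fin (n + 1)) := {i | c i = M}
  let T : Finset (Fin (n + 1)) := {j | b j + K = M * m}
  have hdeg : ∀ j I, coeff I (f j) ≠ 0 → ∑ i, (I i : ℤ) = m := fun j I hI ↦ by
    have := hhom j hI
    rw [Finsupp.weight_apply, Finsupp.sum_fintype _ _ (by simp)] at this
    rw [← this]
    simp
  have hbarcoeff : ∀ j I, coeff I (fbar j) ≠ 0 →
      (∑ l, c l * (I l : ℤ)) - b j = K ∧ coeff I (f j) ≠ 0 := fun j I hI ↦ by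
    rw [hfbar] at hI
    simpa using hI
  have hcard : S.card ≤ T.card := by
    classical
    let s : Finset (MvPolynomial (Fin (n + 1)) k) := T.image fbar ∪ Sᶜ.image X
    have hs : zeroLocus k (Ideal.span (s : Set (MvPolynomial (Fin (n + 1)) k))) = {0} := by
      rw [zeroLocus_span]
      ext x
      simp only [Set.mem_ofPred_eq, Set.mem_singleton_iff]
      constructor
      · intro hx
        refine hbarmor x fun j ↦ ?_
        by_cases hj : j ∈ T
        · exact hx _ (by
            simp only [s, Finset.coe_union, Finset.coe_image]
            exact Or.inl ⟨j, hj, rfl⟩)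
        have hxS : ∀ i ∉ S, x i = 0 := fun i hi ↦ by
          simpa using hx (X i) (by
            simp only [s, Finset.coe_union, Finset.coe_image]
            exact Or.inr ⟨i, by simpa using hi, rfl⟩)
        rw [eval_eq']
        refine Finset.sum_eq_zero fun I hI ↦ ?_
        obtain ⟨hw, hfI⟩ := hbarcoeff j I (mem_support_iff.mp hI)
        obtain ⟨i, hiS, hIi⟩ : ∃ i ∉ S, I i ≠ 0 := by
          by_contra! h
          refine hj (Finset.mem_filter.mpr ⟨Finset.mem_univ _, ?_⟩)
          rw [← hdeg j I hfI, Finset.mul_sum, ← hw, add_sub_cancel]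
          refine Finset.sum_congr rfl fun i _ ↦ ?_
          by_cases hi : i ∈ S
          · rw [(Finset.mem_filter.mp hi).2]
          · simp [h i hi]
        rw [Finset.prod_eq_zero (Finset.mem_univ i) (by rw [hxS i hiS, zero_pow hIi]), mul_zero]
      · rintro rfl p hp
        simp only [s, Finset.coe_union, Finset.coe_image] at hp
        obtain ⟨j, -, rfl⟩ | ⟨i, -, rfl⟩ := hp
        · by_contra h
          rw [aeval_zero, constantCoeff_eq] at h
          replace h : coeff 0 (fbar j) ≠ 0 := fun h0 ↦ h (by rw [h0, map_zero])
          have := hdeg j 0 (hbarcoeff j 0 h).2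
          simp at this
          omega
        · simp
    have h1 := card_le_card_of_zeroLocus_span_eq_singleton s 0 hs
    have h2 : s.card ≤ T.card + Sᶜ.card :=
      (Finset.card_union_le _ _).trans (add_le_add Finset.card_image_le Finset.card_image_le)
    have h3 := Finset.card_add_card_compl S
    simp only [Nat.card_eq_fintype_card] at h1
    omega
  obtain ⟨T', hT', hcardT'⟩ := Finset.exists_subset_card_eq hcard
  have hS : S.Nonempty := ⟨i₀, by simp [S, M]⟩
  refine ⟨S, T', hS, Finset.card_pos.mp (hcardT' ▸ hS.card_pos), hcardT'.symm, ?_, ?_⟩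
  · obtain ⟨i, i', hii'⟩ := hc
    have : S.card < (Finset.univ : Finset (Fin (n + 1))).card := by
      refine Finset.card_lt_card (Finset.ssubset_univ_iff.mpr fun h ↦ hii' ?_)
      have hall : ∀ l, c l = M := fun l ↦ by
        have hl : l ∈ S := h ▸ Finset.mem_univ l
        exact (Finset.mem_filter.mp hl).2
      rw [hall, hall]
    rw [Finset.card_fin] at this
    omega
  · intro j hj I hI i hi
    have hjT : b j + K = M * m := (Finset.mem_filter.mp (hT' hj)).2
    have hw := hhalf j I hI
    have hle : ∀ l ∈ Finset.univ, c l * (I l : ℤ) ≤ M * I l := fun l _ ↦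
      mul_le_mul_of_nonneg_right (hi₀ l (Finset.mem_univ l)) (Int.natCast_nonneg _)
    have heq : ∑ l, c l * (I l : ℤ) = ∑ l, M * (I l : ℤ) := by
      refine le_antisymm (Finset.sum_le_sum hle) ?_
      rw [← Finset.mul_sum, hdeg j I hI]
      linarith
    have hi' := (Finset.sum_eq_sum_iff_of_le hle).mp heq i (Finset.mem_univ i)
    by_contra hIi
    exact hi (Finset.mem_filter.mpr
      ⟨Finset.mem_univ _, mul_right_cancel₀ (Nat.cast_ne_zero.mpr hIi) hi'⟩)
end

section
/- Let k be an algebraically closed field, n ≥ 1, m ≥ 1, and f = (f_0, …, f_n) a tuple of homogeneous polynomials of degree m in x_0, …, x_n over k whose only common zero in k^{n+1} is the origin. Let 0 ≤ s < n and suppose that for every j ≤ s the polynomial f_j involves only the variables x_0, …, x_s (every monomial of f_j has exponent 0 in each x_i with i > s). Then for every point x = (x_0, …, x_n) ∈ k^{n+1} with f_0(x) = f_1(x) = ⋯ = f_s(x) = 0 one has x_0 = x_1 = ⋯ = x_s = 0. (Projectively: the preimage under the morphism f : ℙ^n → ℙ^n of the linear subspace {y_0 = ⋯ = y_s = 0}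 is exactly the linear subspace {x_0 = ⋯ = x_s = 0}.) -/
open MvPolynomial

/-- **Affine dimension bound**: a system of polynomial equations over an algebraically closed field
with exactly one solution has at least as many equations as variables. -/
theorem MvPolynomial.natCard_le_of_unique_zero {k σ ι : Type*} [Field k] [IsAlgClosed k]
    [Finite σ] [Fintype ι] (g : ι → MvPolynomial σ k) (a : σ → k)
    (h : ∀ y : σ → k, (∀ i, eval y (g i) = 0) ↔ y = a) :
    Nat.card σ ≤ Fintype.card ι := by
  classical
  have hdim : ringKrullDim (MvPolynomial σ k) ≤ ((Fintype.card ι : ℕ∞) : WithBot ℕ∞) := by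
    refine (ringKrullDim_le_iff_isMaximal_height_le _).mpr fun M hM => ?_
    obtain ⟨x, rfl⟩ := eq_vanishingIdeal_singleton_of_isMaximal k hM
    -- Translate the system so that its unique solution is `x`.
    let g' : ι → MvPolynomial σ k := fun i => aeval (fun j => X j - C (x j) + C (a j)) (g i)
    have hg' (y : σ → k) (i : ι) : eval y (g' i) = eval (y - x + a) (g i) := by
      change aeval y (aeval _ (g i)) = _
      rw [← AlgHom.comp_apply, comp_aeval, ← coe_aeval_eq_eval, RingHom.coe_coe]
      simp only [map_add, map_sub, aeval_X, aeval_C, Algebra.algebraMap_self, RingHom.id_apply]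
      rfl
    have hz : zeroLocus k (Ideal.span (Set.range g')) = {x} := by
      ext y
      simp [zeroLocus_span, hg', h, sub_eq_zero]
    have hmin : vanishingIdeal k {x} ∈ (Ideal.span (Set.range g')).minimalPrimes := by
      rw [← Ideal.radical_minimalPrimes, ← vanishingIdeal_zeroLocus_eq_radical (K := k), hz,
        Ideal.minimalPrimes_eq_subsingleton_self]
      rfl
    have hle := Ideal.height_le_card_of_mem_minimalPrimes_span (Set.finite_range g') hmin
    have hcard : (Set.range g').ncard ≤ Fintype.card ι := by
      rw [← Set.image_univ]
      exact (Set.ncard_image_le Set.finite_univ).trans (by simp [Set.ncard_univ])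
    exact_mod_cast hle.trans (by exact_mod_cast hcard)
  simpa only [ringKrullDim_of_isNoetherianRing, ringKrullDim_eq_zero_of_field, zero_add,
    WithBot.coe_natCast, Nat.cast_le] using hdim

/-- A homogeneous polynomial of degree `m` scales by `c ^ m` when its argument is scaled by `c`. -/
theorem MvPolynomial.IsHomogeneous.eval_const_mul {R σ : Type*} [CommSemiring R]
    {p : MvPolynomial σ R} {m : ℕ} (hp : p.IsHomogeneous m) (c : R) (x : σ → R) :
    eval (fun i => c * x i) p = c ^ m * eval x p := by
  rw [eval_eq, eval_eq, Finset.mul_sum]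
  refine Finset.sum_congr rfl fun d hd => ?_
  rw [hp.degree_eq_sum_deg_support hd]
  simp only [mul_pow, Finset.prod_mul_distrib, Finset.prod_pow_eq_pow_sum]
  ring

/-- If a morphism `ℙⁿ → ℙⁿ` is such that `f_0, …, f_s` involve only the variables
`x_0, …, x_s`, then the preimage of the subspace `{y_0 = ⋯ = y_s = 0}` is the
subspace `{x_0 = ⋯ = x_s = 0}`. -/
theorem preimage_of_linear_subspace
    {k : Type*} [Field k] [IsAlgClosed k]
    (n m : ℕ) (hn : 1 ≤ n) (hm : 1 ≤ m)
    (f : Fin (n + 1) → MvPolynomial (Fin (n + 1)) k)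
    (hhom : ∀ j, (f j).IsHomogeneous m)
    (hmor : ∀ x : Fin (n + 1) → k, (∀ j, eval x (f j) = 0) → x = 0)
    (s : ℕ) (hs : s < n)
    (hvars : ∀ j : Fin (n + 1), (j : ℕ) ≤ s →
      ∀ I : Fin (n + 1) →₀ ℕ, coeff I (f j) ≠ 0 →
        ∀ i : Fin (n + 1), s < (i : ℕ) → I i = 0) :
    ∀ x : Fin (n + 1) → k,
      (∀ j : Fin (n + 1), (j : ℕ) ≤ s → eval x (f j) = 0) →
      ∀ i : Fin (n + 1), (i : ℕ) ≤ s → x i = 0 := by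
  intro x hx i₀ hi₀
  by_contra hne
  -- Restrict the remaining `f_j` to the span of `(x_0, …, x_s, 0, …, 0)` and the last coordinates.
  let v : Fin (n + 1) → MvPolynomial (Option {j : Fin (n + 1) // s < (j : ℕ)}) k :=
    fun i => if h : s < (i : ℕ) then X (some ⟨i, h⟩) else X none * C (x i)
  let g : {j : Fin (n + 1) // s < (j : ℕ)} → MvPolynomial _ k := fun j => aeval v (f j)
  have hg (y) (j) : eval y (g j) = eval (fun i => eval y (v i)) (f j) := by
    change eval y (aeval v (f j)) = _
    rw [← coe_aeval_eq_eval, ← coe_aeval_eq_eval, RingHom.coe_coe, RingHom.coe_coe,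
      ← AlgHom.comp_apply, comp_aeval]
  have hv_last (y) (j : {j : Fin (n + 1) // s < (j : ℕ)}) : eval y (v j) = y (some j) := by
    simp [v, j.2]
  have hv_first (y) (i : Fin (n + 1)) (hi : (i : ℕ) ≤ s) : eval y (v i) = y none * x i := by
    simp [v, hi.not_gt]
  suffices huniq : ∀ y, (∀ j, eval y (g j) = 0) ↔ y = 0 by
    have := natCard_le_of_unique_zero g 0 huniq
    simp at this
  refine fun y => ⟨fun hy => ?_, ?_⟩
  · have hzero : (fun i => eval y (v i)) = 0 := by
      refine hmor _ fun j => ?_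
      rcases lt_or_ge s (j : ℕ) with hj | hj
      · exact (hg y ⟨j, hj⟩).symm.trans (hy ⟨j, hj⟩)
      · have hcongr : eval (fun i => eval y (v i)) (f j) = eval (fun i => y none * x i) (f j) := by
          refine eval₂Hom_congr' rfl (fun i hi _ => hv_first y i ?_) rfl
          obtain ⟨I, hI, hiI⟩ := (mem_vars_iff_mem_support i).mp hi
          by_contra! hlt
          exact Finsupp.mem_support_iff.mp hiI (hvars j hj I (mem_support_iff.mp hI) i hlt)
        rw [hcongr, (hhom j).eval_const_mul, hx j hj, mul_zero]
    funext o
    cases o with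
    | none =>
      have := congrFun hzero i₀
      rw [hv_first y i₀ hi₀] at this
      exact (mul_eq_zero.mp this).resolve_right hne
    | some j => exact (hv_last y j).symm.trans (congrFun hzero j)
  · rintro rfl j
    have hv_zero : (fun i => eval 0 (v i)) = fun i => (0 : k) * x i := by
      funext i
      rcases lt_or_ge s (i : ℕ) with hi | hi
      · simpa using hv_last 0 ⟨i, hi⟩
      · exact hv_first 0 i hi
    rw [hg, hv_zero, (hhom j).eval_const_mul, zero_pow (by lia), zero_mul]
end

section
/- Let k be an algebraically closed field, n ≥ 1, m ≥ 1, and f = (f_0, …, f_n) a tuple of homogeneous polynomials of degree m in x_0, …, x_n over k whose only common zero in k^{n+1} is the origin. Let 0 ≤ s < n and suppose that for every j ≤ s the polynomial f_j involves only the variables x_0, …, x_s. Then the polynomials f_0, …, f_s, regarded as homogeneous polynomials of degree m in the s+1 variables x_0, …, x_s, have no common zero in k^{s+1} other than the origin. (Hence (f_0, …, f_s) defines a morphism ℙ^s → ℙ^s of degree m^s; this is the regularity of the induced map ψ : ℙ(E/E_0) → ℙ(F/F_0) on quotient bundles.) -/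
open MvPolynomial

/-- The ideal of the origin in affine space has maximal height. -/
theorem MvPolynomial.height_vanishingIdeal_singleton_zero {σ k : Type*} [Fintype σ] [Field k]
    [IsAlgClosed k] :
    (vanishingIdeal k {(0 : σ → k)}).height = Fintype.card σ := by
  have hdim : ringKrullDim (MvPolynomial σ k) = ((Fintype.card σ : ℕ∞) : WithBot ℕ∞) := by
    simp
  have : FiniteRingKrullDim (MvPolynomial σ k) := by
    rw [finiteRingKrullDim_iff_ne_bot_and_top, hdim]
    exact ⟨WithBot.coe_ne_bot, by
      rw [← WithBot.coe_top, Ne, WithBot.coe_inj]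
      exact ENat.natCast_ne_top _⟩
  obtain ⟨M, hM, hMh⟩ := Ideal.exists_isMaximal_height (R := MvPolynomial σ k)
  obtain ⟨a, rfl⟩ := isMaximal_iff_eq_vanishingIdeal_singleton.mp hM
  let e : MvPolynomial σ k ≃ₐ[k] MvPolynomial σ k :=
    AlgEquiv.ofAlgHom (aeval fun i => X i - C (a i)) (aeval fun i => X i + C (a i))
      (by ext i; simp [← algebraMap_eq]) (by ext i; simp [← algebraMap_eq])
  have he : vanishingIdeal k {(0 : σ → k)} =
      (vanishingIdeal k {a}).comap e.toRingEquiv := by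
    ext p
    rw [Ideal.mem_comap, mem_vanishingIdeal_singleton_iff, mem_vanishingIdeal_singleton_iff]
    have h : (aeval (R := k) a).comp e.toAlgHom = aeval 0 := by
      ext i
      simp [e]
    rw [← h]
    rfl
  rw [he, RingEquiv.height_comap]
  rw [hdim] at hMh
  exact WithBot.coe_injective hMh

/-- Fewer equations than unknowns, all satisfied at the origin, have another common zero. -/
theorem MvPolynomial.exists_ne_zero_forall_eval_eq_zero {σ ι k : Type*} [Fintype σ] [Fintype ι]
    [Field k] [IsAlgClosed k] (hcard : Fintype.card ι < Fintype.card σ)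
    (g : ι → MvPolynomial σ k) (hg : ∀ i, eval 0 (g i) = 0) :
    ∃ z : σ → k, z ≠ 0 ∧ ∀ i, eval z (g i) = 0 := by
  by_contra! H
  have hzero : zeroLocus k (Ideal.span (Set.range g)) = {0} := by
    rw [zeroLocus_span]
    ext z
    simp only [Set.forall_mem_range, Set.mem_ofPred_eq, Set.mem_singleton_iff, aeval_eq_eval]
    refine ⟨fun h => ?_, fun h i => h ▸ hg i⟩
    by_contra hz
    obtain ⟨i, hi⟩ := H z hz
    exact hi (h i)
  have hrad := vanishingIdeal_zeroLocus_eq_radical (K := k) (Ideal.span (Set.range g))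
  rw [hzero] at hrad
  have hmin : vanishingIdeal k {(0 : σ → k)} ∈ (Ideal.span (Set.range g)).minimalPrimes := by
    rw [← Ideal.radical_minimalPrimes, ← hrad, Ideal.minimalPrimes_eq_subsingleton_self]
    rfl
  have hle := Ideal.height_le_card_of_mem_minimalPrimes_span (Set.finite_range g) hmin
  rw [height_vanishingIdeal_singleton_zero, Nat.cast_le, ← Set.image_univ] at hle
  have hc := Set.ncard_image_le (f := g) (s := Set.univ)
  rw [Set.ncard_univ, Nat.card_eq_fintype_card] at hc
  omega

/-- A form of degree `m` scales by `t ^ m` along a vector which is `t` times a given one in the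
coordinates that the form involves. -/
theorem MvPolynomial.IsHomogeneous.eval_eq_pow_mul_eval {σ k : Type*} [Fintype σ] [CommSemiring k]
    {p : MvPolynomial σ k} {m : ℕ} (hp : p.IsHomogeneous m) {x z : σ → k} {t : k}
    (h : ∀ d, coeff d p ≠ 0 → ∀ i, d i ≠ 0 → z i = t * x i) :
    eval z p = t ^ m * eval x p := by
  rw [eval_eq', eval_eq', Finset.mul_sum]
  refine Finset.sum_congr rfl fun d hd => ?_
  rw [mem_support_iff] at hd
  have hdeg : ∑ i, d i = m := by
    rw [← hp hd, Finsupp.weight_apply, Finsupp.sum_fintype] <;> simp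
  have hprod : ∏ i, z i ^ d i = t ^ m * ∏ i, x i ^ d i := by
    rw [← hdeg, ← Finset.prod_pow_eq_pow_sum, ← Finset.prod_mul_distrib]
    refine Finset.prod_congr rfl fun i _ => ?_
    by_cases hi : d i = 0
    · simp [hi]
    · rw [h d hd i hi, mul_pow]
  rw [hprod, mul_left_comm]

/-- If a morphism `ℙⁿ → ℙⁿ` is such that `f_0, …, f_s` involve only the variables
`x_0, …, x_s`, then `f_0, …, f_s`, viewed as forms in `x_0, …, x_s`, have no common
zero in `k^{s+1}` other than the origin; hence they define a morphism `ℙˢ → ℙˢ`. -/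
theorem induced_map_regular
    {k : Type*} [Field k] [IsAlgClosed k]
    (n m : ℕ) (hn : 1 ≤ n) (hm : 1 ≤ m)
    (f : Fin (n + 1) → MvPolynomial (Fin (n + 1)) k)
    (hhom : ∀ j, (f j).IsHomogeneous m)
    (hmor : ∀ x : Fin (n + 1) → k, (∀ j, eval x (f j) = 0) → x = 0)
    (s : ℕ) (hs : s < n)
    (hvars : ∀ j : Fin (n + 1), (j : ℕ) ≤ s →
      ∀ I : Fin (n + 1) →₀ ℕ, coeff I (f j) ≠ 0 →
        ∀ i : Fin (n + 1), s < (i : ℕ) → I i = 0) :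
    ∀ x : Fin (n + 1) → k,
      (∀ i : Fin (n + 1), s < (i : ℕ) → x i = 0) →
      (∀ j : Fin (n + 1), (j : ℕ) ≤ s → eval x (f j) = 0) →
      x = 0 := by
  intro x hx hfx
  by_contra hne
  obtain ⟨c, hc⟩ := Function.ne_iff.mp hne
  have hcs : (c : ℕ) ≤ s := not_lt.mp fun h => hc (hx c h)
  let g : {j : Fin (n + 1) // j ≠ c} → MvPolynomial (Fin (n + 1)) k := fun j =>
    if (j : ℕ) ≤ s then C (x c) * X j.1 - C (x j) * X c else f j
  have hg : ∀ j, eval 0 (g j) = 0 := by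
    intro j
    by_cases hj : (j : ℕ) ≤ s
    · simp [g, hj]
    · have h0 := (hhom j).eval_eq_pow_mul_eval (x := x) (z := 0) (t := 0) (by simp)
      simpa [g, hj, zero_pow (Nat.one_le_iff_ne_zero.mp hm)] using h0
  obtain ⟨z, hz, hgz⟩ := exists_ne_zero_forall_eval_eq_zero
    (Fintype.card_subtype_lt (p := fun j => j ≠ c) (x := c) (by simp)) g hg
  have hlin : ∀ i : Fin (n + 1), (i : ℕ) ≤ s → z i = z c / x c * x i := by
    intro i hi
    have hc' : x c ≠ 0 := hc
    by_cases hic : i = c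
    · rw [hic, div_mul_cancel₀ _ hc']
    · have h := hgz ⟨i, hic⟩
      simp only [g, hi, if_true, map_sub, map_mul, eval_C, eval_X] at h
      field_simp
      linear_combination h
  refine hz (hmor z fun j => ?_)
  by_cases hj : (j : ℕ) ≤ s
  · rw [(hhom j).eval_eq_pow_mul_eval (x := x) (t := z c / x c), hfx j hj, mul_zero]
    intro d hd i hi
    exact hlin i (not_lt.mp fun h => hi (hvars j hj d hd i h))
  · have hjc : j ≠ c := fun h => hj (h ▸ hcs)
    simpa [g, hj] using hgz ⟨j, hjc⟩
end
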